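/- arXiv:1810.03953 — 5 statements merged into one kernel-verified Lean document; each statement's English description precedes it below -/
import Mathlib

section
/- Any two almost para-Hermitian structures with the same compatible metric are related by a change of polarization: if K and K' are two linear maps E → E with K ∘ K = id, K' ∘ K' = id, η(K u, K v) = −η(u, v) and η(K' u, K' v) = −η(u, v) for all u, v ∈ E, then there exists an invertible linear map ϑ : E → E with η(ϑ u, ϑ v) = η(u, v) for all u, v, such that K' = ϑ⁻¹ ∘ K ∘ ϑ. -/
theorem normalForm {E : Type*} [AddCommGroup E] [Module ℝ E] [FiniteDimensional ℝ E]
    (η : E →ₗ[ℝ] E →ₗ[ℝ] ℝ)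
    (hsymm : ∀ u v : E, η u v = η v u)
    (hnondeg : ∀ u : E, (∀ v : E, η u v = 0) → u = 0)
    (K : E →ₗ[ℝ] E)
    (hK : ∀ v : E, K (K v) = v)
    (hcompat : ∀ u v : E, η (K u) (K v) = -η u v) :
    ∃ n : ℕ, ∃ Φ : E ≃ₗ[ℝ] (Fin n → ℝ) × Module.Dual ℝ (Fin n → ℝ),
      (∀ u v, η u v = (Φ u).2 (Φ v).1 + (Φ v).2 (Φ u).1) ∧
      (∀ u, Φ (K u) = ((Φ u).1, -(Φ u).2)) := by
  let L : Submodule ℝ E := LinearMap.ker (K - LinearMap.id)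
  have memL : ∀ v, v ∈ L ↔ K v = v := fun v => by
    simp [L, sub_eq_zero]
  let P : E →ₗ[ℝ] E := (1/2 : ℝ) • (LinearMap.id + K)
  let Q : E →ₗ[ℝ] E := (1/2 : ℝ) • (LinearMap.id - K)
  have hP : ∀ v, P v = (1/2 : ℝ) • (v + K v) := fun v => by simp [P]
  have hQ : ∀ v, Q v = (1/2 : ℝ) • (v - K v) := fun v => by simp [Q]
  have hPQ : ∀ v, P v + Q v = v := fun v => by rw [hP, hQ]; module
  have KP : ∀ v, K (P v) = P v := fun v => by
    rw [hP, map_smul, map_add, hK, add_comm]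
  have KQ : ∀ v, K (Q v) = - Q v := fun v => by
    rw [hQ, map_smul, map_sub, hK]; module
  let e : L ≃ₗ[ℝ] (Fin (Module.finrank ℝ L) → ℝ) := (Module.finBasis ℝ L).equivFun
  let A : E →ₗ[ℝ] (Fin (Module.finrank ℝ L) → ℝ) :=
    e.toLinearMap ∘ₗ P.codRestrict L (fun v => (memL _).2 (KP v))
  let j : (Fin (Module.finrank ℝ L) → ℝ) →ₗ[ℝ] E := L.subtype ∘ₗ e.symm.toLinearMap
  have jA : ∀ v, j (A v) = P v := fun v => by simp [j, A]
  have Kj : ∀ x, K (j x) = j x := fun x => (memL _).1 (e.symm x).2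
  have jinj : Function.Injective j := fun x y h => e.symm.injective (Subtype.ext h)
  have plus0 : ∀ u v, K u = u → K v = v → η u v = 0 := fun u v hu hv => by
    have := hcompat u v
    rw [hu, hv] at this; linarith
  have minus0 : ∀ u v, K u = -u → K v = -v → η u v = 0 := fun u v hu hv => by
    have := hcompat u v
    rw [hu, hv] at this; simp at this; linarith
  let B : E →ₗ[ℝ] Module.Dual ℝ (Fin (Module.finrank ℝ L) → ℝ) := j.dualMap ∘ₗ η ∘ₗ Q
  have hB : ∀ v x, B v x = η (Q v) (j x) := fun v x => rfl
  have form : ∀ u v, η u v = B u (A v) + B v (A u) := fun u v => by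
    rw [hB, hB, jA, jA]
    conv_lhs => rw [← hPQ u, ← hPQ v]
    simp only [map_add, LinearMap.add_apply]
    rw [plus0 _ _ (KP u) (KP v), minus0 _ _ (KQ u) (KQ v), hsymm (P u) (Q v)]
    ring
  have ηinj : Function.Injective η := by
    rw [← LinearMap.ker_eq_bot, LinearMap.ker_eq_bot']
    intro u hu
    exact hnondeg u fun v => by rw [hu]; rfl
  have ηsurj : Function.Surjective η :=
    (LinearMap.injective_iff_surjective_of_finrank_eq_finrank
      (Subspace.dual_finrank_eq (K := ℝ) (V := E)).symm).1 ηinj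
  have inj : Function.Injective (A.prod B) := by
    rw [← LinearMap.ker_eq_bot, LinearMap.ker_eq_bot']
    intro u hu
    have h1 : A u = 0 := congrArg Prod.fst hu
    have h2 : B u = 0 := congrArg Prod.snd hu
    exact hnondeg u fun v => by rw [form, h1, h2]; simp
  have Aj : ∀ x, A (j x) = x := fun x => jinj (by
    rw [jA, hP, Kj]; module)
  have surj : Function.Surjective (A.prod B) := by
    rintro ⟨x, φ⟩
    obtain ⟨w, hw⟩ := ηsurj (φ ∘ₗ A)
    have hQj : Q (j x) = 0 := by rw [hQ, Kj]; simp
    have hPQw : P (Q w) = 0 := by rw [hP, KQ]; simp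
    have hQQ : Q (Q w) = Q w := by rw [hQ (Q w), KQ]; module
    have hAQ : A (Q w) = 0 := jinj (by rw [jA, hPQw, map_zero])
    refine ⟨j x + Q w, Prod.ext ?_ ?_⟩
    · change A (j x + Q w) = x
      rw [map_add, Aj, hAQ, add_zero]
    · change B (j x + Q w) = φ
      refine LinearMap.ext fun y => ?_
      rw [hB, map_add, hQj, hQQ, zero_add]
      have h1 : η w (j y) = φ y := by
        rw [hw, LinearMap.comp_apply, Aj]
      rw [← h1]
      conv_rhs => rw [← hPQ w]
      rw [map_add, LinearMap.add_apply, plus0 _ _ (KP w) (Kj y), zero_add]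
  refine ⟨_, LinearEquiv.ofBijective (A.prod B) ⟨inj, surj⟩, form, fun u => ?_⟩
  refine Prod.ext ?_ ?_
  · change A (K u) = A u
    apply jinj
    rw [jA, jA, hP, hP, hK, add_comm]
  · change B (K u) = - B u
    have : Q (K u) = - Q u := by rw [hQ, hQ, hK]; module
    refine LinearMap.ext fun y => ?_
    rw [LinearMap.neg_apply, hB, hB, this]; simp

/-- Any two almost para-Hermitian structures `K`, `K'` compatible with
the same nondegenerate symmetric bilinear form `η` on a finite-dimensional real vector
space are related by a change of polarization: there is an isometry `ϑ` of `η` with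
`K' = ϑ⁻¹ ∘ K ∘ ϑ`. -/
theorem stmt7 {E : Type*} [AddCommGroup E] [Module ℝ E] [FiniteDimensional ℝ E]
    (η : E →ₗ[ℝ] E →ₗ[ℝ] ℝ)
    (hsymm : ∀ u v : E, η u v = η v u)
    (hnondeg : ∀ u : E, (∀ v : E, η u v = 0) → u = 0)
    (K K' : E →ₗ[ℝ] E)
    (hK : ∀ v : E, K (K v) = v)
    (hK' : ∀ v : E, K' (K' v) = v)
    (hcompat : ∀ u v : E, η (K u) (K v) = -η u v)
    (hcompat' : ∀ u v : E, η (K' u) (K' v) = -η u v) :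
    ∃ ϑ : E ≃ₗ[ℝ] E, (∀ u v : E, η (ϑ u) (ϑ v) = η u v) ∧
      ∀ u : E, K' u = ϑ.symm (K (ϑ u)) := by
  obtain ⟨n, Φ, h1, h2⟩ := normalForm η hsymm hnondeg K hK hcompat
  obtain ⟨m, Ψ, h3, h4⟩ := normalForm η hsymm hnondeg K' hK' hcompat'
  have hn : n = m := by
    have a := Φ.symm.finrank_eq
    have b := Ψ.symm.finrank_eq
    rw [Module.finrank_prod, Subspace.dual_finrank_eq, Module.finrank_fin_fun] at a b
    omega
  subst hn
  refine ⟨Ψ.trans Φ.symm, fun u v => ?_, fun u => ?_⟩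
  · rw [h1, h3]; simp
  · rw [LinearEquiv.eq_symm_apply]
    apply Φ.injective
    rw [h2]
    simp [h4]
end

section
/- The Lie derivative of the vertical endomorphism along a second-order vector field is an almost para-complex structure: define K(x) : ℝ^d × ℝ^d → ℝ^d × ℝ^d by K(x)(a, b) := (−a, b − A(x)a), where A(x)a := DΦ(x)(0, a). Then: (i) for every C¹ vector field X on ℝ^d × ℝ^d and every point x, ([Σ, S∘X] − S∘[Σ, X])(x) = K(x)(X(x)), i.e. K is the (1,1)-tensor £_Σ S; (ii) K(x) ∘ K(x) = id for every x; (iii) the +1-eigenspace of K(x) is the vertical subspace {0} × ℝ^d, and the −1-eigenspace of K(x) is {(a, ½·A(x)a) : a ∈ ℝ^d}, the horizontal subspace spanned by the vectors D_i = (e_i, ½·A(x)e_i). -/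
/-- The Lie bracket of vector fields: `[V,W](x) = DW(x)(V(x)) − DV(x)(W(x))`. -/
noncomputable def lieBracket {E : Type*} [NormedAddCommGroup E] [NormedSpace ℝ E]
    (V W : E → E) : E → E :=
  fun x => fderiv ℝ W x (V x) - fderiv ℝ V x (W x)

/-- For a second-order vector field `Σ(q,v) = (v, Φ(q,v))` and the
vertical endomorphism `S(a,b) = (0,a)`, the map `K(x)(a,b) := (−a, b − A(x)a)` with
`A(x)a = DΦ(x)(0,a)` satisfies: (i) `K = £_Σ S`, i.e. `[Σ, S∘X] − S∘[Σ, X] = K(X)`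
for every C¹ vector field `X`; (ii) `K(x)² = id`; (iii) the `+1`-eigenspace of `K(x)`
is the vertical subspace `{0} × ℝ^d` and the `−1`-eigenspace is the horizontal
subspace `{(a, ½·A(x)a) : a ∈ ℝ^d}`. -/
theorem stmt10 {d : ℕ}
    (Φ : (Fin d → ℝ) × (Fin d → ℝ) → (Fin d → ℝ))
    (hΦ : ContDiff ℝ 2 Φ)
    (Sg : (Fin d → ℝ) × (Fin d → ℝ) → (Fin d → ℝ) × (Fin d → ℝ))
    (hSg : ∀ x : (Fin d → ℝ) × (Fin d → ℝ), Sg x = (x.2, Φ x))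
    (S : (Fin d → ℝ) × (Fin d → ℝ) → (Fin d → ℝ) × (Fin d → ℝ))
    (hS : ∀ p : (Fin d → ℝ) × (Fin d → ℝ), S p = (0, p.1))
    (A : ((Fin d → ℝ) × (Fin d → ℝ)) → (Fin d → ℝ) → (Fin d → ℝ))
    (hA : ∀ (x : (Fin d → ℝ) × (Fin d → ℝ)) (a : Fin d → ℝ),
      A x a = fderiv ℝ Φ x (0, a))
    (K : ((Fin d → ℝ) × (Fin d → ℝ)) → ((Fin d → ℝ) × (Fin d → ℝ)) →
      ((Fin d → ℝ) × (Fin d → ℝ)))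
    (hK : ∀ (x p : (Fin d → ℝ) × (Fin d → ℝ)), K x p = (-p.1, p.2 - A x p.1)) :
    (∀ X : ((Fin d → ℝ) × (Fin d → ℝ)) → ((Fin d → ℝ) × (Fin d → ℝ)),
      ContDiff ℝ 1 X → ∀ x : (Fin d → ℝ) × (Fin d → ℝ),
        lieBracket Sg (fun y => S (X y)) x - S (lieBracket Sg X x) = K x (X x)) ∧
    (∀ x p : (Fin d → ℝ) × (Fin d → ℝ), K x (K x p) = p) ∧
    (∀ x : (Fin d → ℝ) × (Fin d → ℝ),
      {p : (Fin d → ℝ) × (Fin d → ℝ) | K x p = p} =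
        ({0} : Set (Fin d → ℝ)) ×ˢ (Set.univ : Set (Fin d → ℝ))) ∧
    (∀ x : (Fin d → ℝ) × (Fin d → ℝ),
      {p : (Fin d → ℝ) × (Fin d → ℝ) | K x p = -p} =
        Set.range (fun a : Fin d → ℝ => (a, ((1 : ℝ) / 2) • A x a))) := by
  have hneg : ∀ (x : (Fin d → ℝ) × (Fin d → ℝ)) (a : Fin d → ℝ), A x (-a) = -A x a := by
    intro x a
    rw [hA, hA, ← map_neg]
    simp
  have hzero : ∀ x : (Fin d → ℝ) × (Fin d → ℝ), A x 0 = 0 := by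
    intro x
    rw [hA, Prod.mk_zero_zero, map_zero]
  refine ⟨?_, ?_, ?_, ?_⟩
  · intro X hX x
    have hXd : HasFDerivAt X (fderiv ℝ X x) x :=
      (hX.differentiable (by norm_num) x).hasFDerivAt
    have hΦd : HasFDerivAt Φ (fderiv ℝ Φ x) x :=
      (hΦ.differentiable (by norm_num) x).hasFDerivAt
    have hSgd : HasFDerivAt Sg
        ((ContinuousLinearMap.snd ℝ (Fin d → ℝ) (Fin d → ℝ)).prod (fderiv ℝ Φ x)) x := by
      have e : Sg = fun y => (y.2, Φ y) := funext hSg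
      rw [e]
      exact hasFDerivAt_snd.prodMk hΦd
    have hSXd : HasFDerivAt (fun y => S (X y))
        ((0 : (Fin d → ℝ) × (Fin d → ℝ) →L[ℝ] (Fin d → ℝ)).prod
          ((ContinuousLinearMap.fst ℝ (Fin d → ℝ) (Fin d → ℝ)).comp (fderiv ℝ X x))) x := by
      have e : (fun y => S (X y)) = fun y => ((0 : Fin d → ℝ), (X y).1) :=
        funext fun y => hS (X y)
      rw [e]
      exact (hasFDerivAt_const (0 : Fin d → ℝ) x).prodMk (hasFDerivAt_fst.comp x hXd)
    simp only [lieBracket]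
    rw [hSXd.fderiv, hSgd.fderiv, hK, hA, hS, hS]
    ext i <;> simp
  · intro x p
    rw [hK, hK]
    ext i <;> simp [hneg]
  · intro x
    ext p
    simp only [Set.mem_ofPred_eq, Set.mem_prod, Set.mem_singleton_iff, Set.mem_univ, and_true]
    rw [hK, Prod.ext_iff]
    constructor
    · rintro ⟨h, -⟩
      exact neg_eq_self.mp h
    · intro h
      simp [h, hzero]
  · intro x
    ext p
    simp only [Set.mem_ofPred_eq, Set.mem_range]
    rw [hK, Prod.ext_iff]
    constructor
    · rintro ⟨-, h⟩
      refine ⟨p.1, Prod.ext rfl ?_⟩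
      ext i
      have := congrFun h i
      simp at this ⊢
      linarith
    · rintro ⟨a, rfl⟩
      refine ⟨rfl, ?_⟩
      ext i
      simp
      ring
end

section
/- Let E be a finite-dimensional real vector space, Ω a nondegenerate alternating bilinear form on E, and K : E → E a linear map with K ∘ K = id whose eigenspaces L₊ = ker(K − id) and L₋ = ker(K + id) satisfy Ω(u, v) = 0 for all u, v ∈ L₊ and for all u, v ∈ L₋. Then the bilinear form η(u, v) := Ω(K u, v) is symmetric and nondegenerate, the eigenspaces L₊ and L₋ are isotropic with respect to η, and η satisfies the para-Hermitian compatibility condition η(K u, K v) = −η(u, v) for all u, v ∈ E. (This is the pointwise content of the proposition that a regular Lagrangian 2-form Ω_𝓛 together with the dynamical almost para-complex structure K = £_Σ S defines an almost para-Kähler structure (K, η_𝓛) on T𝒬.) -/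
/-- If `Ω` is a nondegenerate alternating bilinear form on a
finite-dimensional real vector space `E` and `K` satisfies `K ∘ K = id` with both
eigenspaces `L₊ = ker(K − id)` and `L₋ = ker(K + id)` Lagrangian for `Ω`, then
`η(u,v) := Ω(K u, v)` is a symmetric nondegenerate bilinear form, the eigenspaces
are isotropic for `η`, and `η(K u, K v) = −η(u,v)`.  (Pointwise content of the
almost para-Kähler structure defined by a regular Lagrangian 2-form.) -/
theorem stmt12 {E : Type*} [AddCommGroup E] [Module ℝ E] [FiniteDimensional ℝ E]
    (Ω : E →ₗ[ℝ] E →ₗ[ℝ] ℝ)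
    (halt : ∀ u : E, Ω u u = 0)
    (hnondeg : ∀ u : E, (∀ v : E, Ω u v = 0) → u = 0)
    (K : E →ₗ[ℝ] E)
    (hK : ∀ v : E, K (K v) = v)
    (hplus : ∀ u v : E, K u = u → K v = v → Ω u v = 0)
    (hminus : ∀ u v : E, K u = -u → K v = -v → Ω u v = 0)
    (η : E → E → ℝ)
    (hη : ∀ u v : E, η u v = Ω (K u) v) :
    (∀ u v : E, η u v = η v u) ∧
    (∀ u : E, (∀ v : E, η u v = 0) → u = 0) ∧
    (∀ u v : E, K u = u → K v = v → η u v = 0) ∧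
    (∀ u v : E, K u = -u → K v = -v → η u v = 0) ∧
    (∀ u v : E, η (K u) (K v) = -η u v) := by
  have skew : ∀ u v : E, Ω u v = -Ω v u := by
    intro u v
    have h := halt (u + v)
    simp only [map_add, LinearMap.add_apply, halt] at h
    linarith
  have key : ∀ u v : E, Ω (K u) v = -Ω u (K v) := by
    intro u v
    have h1 := hplus (u + K u) (v + K v) (by rw [map_add, hK, add_comm])
      (by rw [map_add, hK, add_comm])
    have h2 := hminus (u - K u) (v - K v) (by rw [map_sub, hK, neg_sub])
      (by rw [map_sub, hK, neg_sub])
    simp only [map_add, map_sub, LinearMap.add_apply, LinearMap.sub_apply] at h1 h2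
    linarith
  refine ⟨?_, ?_, ?_, ?_, ?_⟩
  · intro u v
    rw [hη, hη, key, skew (K v) u]
  · intro u h
    have h0 : K u = 0 := hnondeg _ fun v => by rw [← hη]; exact h v
    rw [← hK u, h0, map_zero]
  · intro u v hu hv
    rw [hη, hu]
    exact hplus u v hu hv
  · intro u v hu hv
    rw [hη, hu, map_neg, LinearMap.neg_apply, hminus u v hu hv, neg_zero]
  · intro u v
    rw [hη, hη, key, hK]
end

section
/- Let C be a d×d real matrix, and on E = ℝ^d × ℝ^d define the canonical symplectic form ω₀((a,b),(a',b')) := ⟨b, a'⟩ − ⟨a, b'⟩, the endomorphism K_C(a, b) := (−a, b − 2·Cᵗa), and the bilinear form η_C(u, v) := ω₀(K_C u, v). Then: (i) K_C ∘ K_C = id, its +1-eigenspace is the vertical subspace L_v = {0} × ℝ^d and its −1-eigenspace is the horizontal subspace L_h^C = {(a, Cᵗa) : a ∈ ℝ^d}; (ii) L_v is always isotropic for η_C, and L_h^C is isotropic for η_C if and only if C is symmetric (Cᵗ = C); (iii) if C is symmetric then η_C is symmetric and nondegenerate and satisfies η_C(K_C u, K_C v) = −η_C(u, v), so (K_C,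 η_C) is an almost para-Hermitian structure with fundamental 2-form ω₀. (This is the proposition that the ω₀-compatible almost para-Kähler structures on phase space T*𝒬 correspond exactly to symmetric non-linear connection coefficients C.) -/
open Matrix

/-- On `E = ℝ^d × ℝ^d` with canonical symplectic form
`ω₀((a,b),(a',b')) = ⟨b,a'⟩ − ⟨a,b'⟩`, the endomorphism `K_C(a,b) = (−a, b − 2Cᵗa)`
and the bilinear form `η_C(u,v) = ω₀(K_C u, v)` satisfy: (i) `K_C² = id` with
`+1`-eigenspace the vertical subspace `{0} × ℝ^d` and `−1`-eigenspace the horizontal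
subspace `{(a, Cᵗa)}`; (ii) the vertical subspace is always `η_C`-isotropic, and the
horizontal one is `η_C`-isotropic iff `C` is symmetric; (iii) if `C` is symmetric then
`η_C` is symmetric, nondegenerate and compatible with `K_C`, with fundamental 2-form
`ω₀`. -/
theorem stmt13 {d : ℕ} (C : Matrix (Fin d) (Fin d) ℝ)
    (ω₀ : ((Fin d → ℝ) × (Fin d → ℝ)) → ((Fin d → ℝ) × (Fin d → ℝ)) → ℝ)
    (hω₀ : ∀ u v : (Fin d → ℝ) × (Fin d → ℝ), ω₀ u v = u.2 ⬝ᵥ v.1 - u.1 ⬝ᵥ v.2)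
    (KC : ((Fin d → ℝ) × (Fin d → ℝ)) → ((Fin d → ℝ) × (Fin d → ℝ)))
    (hKC : ∀ u : (Fin d → ℝ) × (Fin d → ℝ),
      KC u = (-u.1, u.2 - (2 : ℝ) • Cᵀ.mulVec u.1))
    (ηC : ((Fin d → ℝ) × (Fin d → ℝ)) → ((Fin d → ℝ) × (Fin d → ℝ)) → ℝ)
    (hηC : ∀ u v : (Fin d → ℝ) × (Fin d → ℝ), ηC u v = ω₀ (KC u) v) :
    (∀ u : (Fin d → ℝ) × (Fin d → ℝ), KC (KC u) = u) ∧
    ({u : (Fin d → ℝ) × (Fin d → ℝ) | KC u = u} =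
      ({0} : Set (Fin d → ℝ)) ×ˢ (Set.univ : Set (Fin d → ℝ))) ∧
    ({u : (Fin d → ℝ) × (Fin d → ℝ) | KC u = -u} =
      Set.range (fun a : Fin d → ℝ => (a, Cᵀ.mulVec a))) ∧
    (∀ u v : (Fin d → ℝ) × (Fin d → ℝ), u.1 = 0 → v.1 = 0 → ηC u v = 0) ∧
    ((∀ a a' : Fin d → ℝ, ηC (a, Cᵀ.mulVec a) (a', Cᵀ.mulVec a') = 0) ↔ Cᵀ = C) ∧
    (Cᵀ = C →
      (∀ u v : (Fin d → ℝ) × (Fin d → ℝ), ηC u v = ηC v u) ∧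
      (∀ u : (Fin d → ℝ) × (Fin d → ℝ),
        (∀ v : (Fin d → ℝ) × (Fin d → ℝ), ηC u v = 0) → u = 0) ∧
      (∀ u v : (Fin d → ℝ) × (Fin d → ℝ), ηC (KC u) (KC v) = -ηC u v) ∧
      (∀ u v : (Fin d → ℝ) × (Fin d → ℝ), ηC (KC u) v = ω₀ u v)) := by
  have hK : ∀ u, KC (KC u) = u := by
    intro u
    ext i
    · simp [hKC]
    · simp [hKC, Matrix.mulVec_neg]
  have hη : ∀ u v, ηC u v = u.2 ⬝ᵥ v.1 - 2 * (Cᵀ.mulVec u.1 ⬝ᵥ v.1) + u.1 ⬝ᵥ v.2 := by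
    intro u v
    simp [hηC, hω₀, hKC, sub_dotProduct, smul_dotProduct]
  have hsym : Cᵀ = C → ∀ a b : Fin d → ℝ, Cᵀ.mulVec a ⬝ᵥ b = a ⬝ᵥ Cᵀ.mulVec b := by
    intro h a b
    rw [Matrix.mulVec_transpose, ← Matrix.dotProduct_mulVec, h]
  refine ⟨hK, ?_, ?_, ?_, ?_, ?_⟩
  · ext u
    simp only [Set.mem_setOf_eq, Set.mem_prod, Set.mem_singleton_iff, Set.mem_univ, and_true]
    constructor
    · intro h
      have h1 := congrArg Prod.fst h
      rw [hKC] at h1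
      funext i
      have h2 := congrFun h1 i
      simp only [Pi.neg_apply] at h2
      simp only [Pi.zero_apply]
      linarith
    · intro h
      rw [hKC]
      ext i <;> simp [h]
  · ext u
    simp only [Set.mem_setOf_eq, Set.mem_range]
    constructor
    · intro h
      have h1 := congrArg Prod.snd h
      rw [hKC] at h1
      refine ⟨u.1, Prod.ext rfl ?_⟩
      funext i
      have h2 := congrFun h1 i
      simp only [Pi.sub_apply, Pi.smul_apply, smul_eq_mul, Prod.snd_neg, Pi.neg_apply] at h2
      simp only
      linarith
    · rintro ⟨a, rfl⟩
      rw [hKC]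
      ext i
      · simp
      · simp only [Pi.sub_apply, Pi.smul_apply, smul_eq_mul, Prod.snd_neg, Pi.neg_apply]
        ring
  · intro u v hu hv
    simp [hη, hu, hv]
  · constructor
    · intro h
      ext i j
      have h1 := h (Pi.single i 1) (Pi.single j 1)
      simp [hη] at h1
      simp only [Matrix.transpose_apply]
      linarith
    · intro h a b
      rw [hη]
      have := hsym h a b
      simp only
      linarith
  · intro h
    refine ⟨?_, ?_, ?_, ?_⟩
    · intro u v
      rw [hη, hη, hsym h u.1 v.1, dotProduct_comm u.1 (Cᵀ.mulVec v.1),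
        dotProduct_comm u.2 v.1, dotProduct_comm u.1 v.2]
      ring
    · intro u hu
      have h1 : u.1 = 0 := by
        have := hu (0, u.1)
        simpa [hη] using this
      have h2 : u.2 = 0 := by
        have := hu (u.2, 0)
        simpa [hη, h1] using this
      exact Prod.ext h1 h2
    · intro u v
      rw [hηC, hK, hω₀, hη, hKC, hsym h u.1 v.1]
      simp only [dotProduct_neg, dotProduct_sub, dotProduct_smul, smul_eq_mul]
      ring
    · intro u v
      rw [hηC, hK]
end

section
/- On ℝ^6 with coordinates (x, y, z, x̃, ỹ, z̃) and a fixed integer m, define the vector fields Z_x = ∂/∂x, Z_y = ∂/∂y, Z_z = ∂/∂z + m·x·∂/∂y, Z̃^x = ∂/∂x̃, Z̃^y = ∂/∂ỹ + m·z·∂/∂x̃ − m·x·∂/∂z̃, and Z̃^z = ∂/∂z̃. Then: (i) [Z_x, Z_z] = m·Z_y and [Z_x, Z_y] = [Z_y, Z_z] = 0, so the distribution spanned by Z_x, Z_y, Z_z is involutive and its vector fields close the Heisenberg Lie algebra; (ii) [Z̃^a, Z̃^b] = 0 for all a, b ∈ {x, y, z}, so the distribution spanned by Z̃^x, Z̃^y,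 Z̃^z is involutive and abelian. (These are the two integrable eigendistributions of the left-invariant para-Hermitian structure of the doubled twisted torus of the Heisenberg group in the nilmanifold polarization.) -/
/-- On `ℝ^6` with coordinates `(x, y, z, x̃, ỹ, z̃)` and a fixed
integer `m`, the vector fields `Z_x = ∂/∂x`, `Z_y = ∂/∂y`, `Z_z = ∂/∂z + m x ∂/∂y`,
`Z̃^x = ∂/∂x̃`, `Z̃^y = ∂/∂ỹ + m z ∂/∂x̃ − m x ∂/∂z̃`, `Z̃^z = ∂/∂z̃` satisfy:
(i) `[Z_x, Z_z] = m Z_y` and `[Z_x, Z_y] = [Z_y, Z_z] = 0`, so the span of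
`Z_x, Z_y, Z_z` is involutive, closing the Heisenberg Lie algebra; (ii) all brackets
among `Z̃^x, Z̃^y, Z̃^z` vanish, so their span is involutive and abelian. -/
theorem stmt19 (m : ℤ)
    (Zx Zy Zz Ztx Zty Ztz : (Fin 6 → ℝ) → (Fin 6 → ℝ))
    (hZx : ∀ x : Fin 6 → ℝ, Zx x = Pi.single 0 1)
    (hZy : ∀ x : Fin 6 → ℝ, Zy x = Pi.single 1 1)
    (hZz : ∀ x : Fin 6 → ℝ, Zz x = Pi.single 2 1 + ((m : ℝ) * x 0) • (Pi.single 1 1 : Fin 6 → ℝ))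
    (hZtx : ∀ x : Fin 6 → ℝ, Ztx x = Pi.single 3 1)
    (hZty : ∀ x : Fin 6 → ℝ, Zty x = Pi.single 4 1 + ((m : ℝ) * x 2) • (Pi.single 3 1 : Fin 6 → ℝ)
      - ((m : ℝ) * x 0) • (Pi.single 5 1 : Fin 6 → ℝ))
    (hZtz : ∀ x : Fin 6 → ℝ, Ztz x = Pi.single 5 1) :
    (∀ x : Fin 6 → ℝ, lieBracket Zx Zz x = (m : ℝ) • Zy x) ∧
    (∀ x : Fin 6 → ℝ, lieBracket Zx Zy x = 0) ∧
    (∀ x : Fin 6 → ℝ, lieBracket Zy Zz x = 0) ∧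
    (∀ V W : (Fin 6 → ℝ) → (Fin 6 → ℝ),
      (V = Ztx ∨ V = Zty ∨ V = Ztz) → (W = Ztx ∨ W = Zty ∨ W = Ztz) →
      ∀ x : Fin 6 → ℝ, lieBracket V W x = 0) := by
  have dc : ∀ (V : (Fin 6 → ℝ) → (Fin 6 → ℝ)) (c : Fin 6 → ℝ), (∀ x, V x = c) →
      ∀ x v, fderiv ℝ V x v = 0 := by
    intro V c h x v
    have : V = fun _ => c := funext h
    subst this
    simp
  have hp : ∀ (i : Fin 6) (x : Fin 6 → ℝ), HasFDerivAt (fun x : Fin 6 → ℝ => (m : ℝ) * x i)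
      ((m : ℝ) • (ContinuousLinearMap.proj i : (Fin 6 → ℝ) →L[ℝ] ℝ)) x := by
    intro i x
    exact (hasFDerivAt_apply i x).const_mul (m : ℝ)
  have dz : ∀ x v, fderiv ℝ Zz x v = ((m : ℝ) * v 0) • (Pi.single 1 1 : Fin 6 → ℝ) := by
    intro x v
    have e : Zz = _ := funext hZz
    rw [e, (((hp 0 x).smul_const (Pi.single 1 1 : Fin 6 → ℝ)).const_add (Pi.single 2 1)).fderiv]
    simp
  have dt : ∀ x v, fderiv ℝ Zty x v = ((m : ℝ) * v 2) • (Pi.single 3 1 : Fin 6 → ℝ)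
      - ((m : ℝ) * v 0) • (Pi.single 5 1 : Fin 6 → ℝ) := by
    intro x v
    have e : Zty = _ := funext hZty
    rw [e, ((((hp 2 x).smul_const (Pi.single 3 1 : Fin 6 → ℝ)).const_add (Pi.single 4 1)).fun_sub
      ((hp 0 x).smul_const (Pi.single 5 1 : Fin 6 → ℝ))).fderiv]
    simp
  have dx := dc Zx _ hZx
  have dy := dc Zy _ hZy
  have dtx := dc Ztx _ hZtx
  have dtz := dc Ztz _ hZtz
  refine ⟨?_, ?_, ?_, ?_⟩
  · intro x
    simp [lieBracket, dx, dz, hZx, hZy]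
  · intro x
    simp [lieBracket, dx, dy]
  · intro x
    simp [lieBracket, dy, dz, hZy]
  · rintro V W (rfl | rfl | rfl) (rfl | rfl | rfl) x <;>
      first
      | exact sub_self _
      | simp [lieBracket, dtx, dtz, dt, hZtx, hZtz]
end
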